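/- arXiv:1509.06191 — 3 statements merged into one kernel-verified Lean document; each statement's English description precedes it below -/
import Mathlib

section
/- Let Ω be a finite set and P an ℓ-step probability distribution on Ω^ℓ with equal marginals. Fix i ∈ [n], j* ∈ [ℓ], values x̄^{∖j*} = (x^{(1)},…,x^{(j*−1)},x^{(j*+1)},…,x^{(ℓ)}) ∈ Ω^{ℓ−1}, y, z ∈ Ω, and β ≥ 0, and suppose P assigns probability at least β to the ℓ-tuple obtained from x̄^{∖j*} by inserting y in position j*, and probability at least β to the ℓ-tuple obtained by inserting z in position j*. Let f^{(1)},…,f^{(ℓ)} : Ωⁿ → [0,1], and define g^{(j)} := R[i, x^{(j)}]f^{(j)} for j ≠ j* and g^{(j*)} := M[i,y,z]f^{(j*)}. Then E[∏_{j=1}^ℓ f^{(j)}(X^{(j)})] ≥ β · E[∏_{j=1}^ℓ g^{(j)}(X^{(j)})]. -/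
namespace SameSetHitting

/-- `P` is a probability distribution on a finite type. -/
def IsDist {α : Type} [Fintype α] (P : α → ℝ) : Prop :=
  (∀ x, 0 ≤ P x) ∧ ∑ x, P x = 1

open Classical in
/-- The `j`-th marginal of an `ℓ`-step distribution `P`. -/
noncomputable def marginal {Ω : Type} [Fintype Ω] {ℓ : ℕ}
    (P : (Fin ℓ → Ω) → ℝ) (j : Fin ℓ) (a : Ω) : ℝ :=
  ∑ x : Fin ℓ → Ω, if x j = a then P x else 0

/-- All `ℓ` marginals of `P` are equal to `π`. -/
def HasMarginals {Ω : Type} [Fintype Ω] {ℓ : ℕ}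
    (P : (Fin ℓ → Ω) → ℝ) (π : Ω → ℝ) : Prop :=
  ∀ j a, marginal P j a = π a

/-- The expectation `E[f(X)]` where `X` has the product law `πⁿ`. -/
noncomputable def exps {Ω : Type} [Fintype Ω] {n : ℕ}
    (π : Ω → ℝ) (f : (Fin n → Ω) → ℝ) : ℝ :=
  ∑ v : Fin n → Ω, (∏ i, π (v i)) * f v

/-- `E[∏_{j} f_j(X^{(j)})]` where the tuples `(X_i^{(1)}, …, X_i^{(ℓ)})`,
`i = 1, …, n`, are i.i.d. with law `P` and `X^{(j)} = (X_1^{(j)}, …, X_n^{(j)})`. -/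
noncomputable def prodExp {Ω : Type} [Fintype Ω] {ℓ n : ℕ}
    (P : (Fin ℓ → Ω) → ℝ) (f : Fin ℓ → ((Fin n → Ω) → ℝ)) : ℝ :=
  ∑ x : Fin ℓ → Fin n → Ω, (∏ i, P (fun j => x j i)) * ∏ j, f j (x j)

/-- Expectation under the single-coordinate multi-step distribution `P`. -/
noncomputable def expP {Ω : Type} [Fintype Ω] {ℓ : ℕ}
    (P : (Fin ℓ → Ω) → ℝ) (f : (Fin ℓ → Ω) → ℝ) : ℝ :=
  ∑ x, P x * f x

/-- Covariance under `P`. -/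
noncomputable def covP {Ω : Type} [Fintype Ω] {ℓ : ℕ}
    (P : (Fin ℓ → Ω) → ℝ) (f g : (Fin ℓ → Ω) → ℝ) : ℝ :=
  expP P (fun x => f x * g x) - expP P f * expP P g

/-- Variance under `P`. -/
noncomputable def varP {Ω : Type} [Fintype Ω] {ℓ : ℕ}
    (P : (Fin ℓ → Ω) → ℝ) (f : (Fin ℓ → Ω) → ℝ) : ℝ :=
  covP P f f

/-- `f` depends only on the coordinates in `S`. -/
def DependsOn {Ω : Type} {ℓ : ℕ} (f : (Fin ℓ → Ω) → ℝ) (S : Finset (Fin ℓ)) : Prop :=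
  ∀ x y : Fin ℓ → Ω, (∀ j ∈ S, x j = y j) → f x = f y

/-- The correlation `ρ(P, S, T)`. -/
noncomputable def rhoST {Ω : Type} [Fintype Ω] {ℓ : ℕ}
    (P : (Fin ℓ → Ω) → ℝ) (S T : Finset (Fin ℓ)) : ℝ :=
  sSup {r : ℝ | ∃ f g : (Fin ℓ → Ω) → ℝ, DependsOn f S ∧ DependsOn g T ∧
    varP P f = 1 ∧ varP P g = 1 ∧ r = covP P f g}

/-- The correlation `ρ(P) = max_j ρ(P, {j}, [ℓ]∖{j})`. -/
noncomputable def rho {Ω : Type} [Fintype Ω] {ℓ : ℕ} (P : (Fin ℓ → Ω) → ℝ) : ℝ :=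
  ⨆ j : Fin ℓ, rhoST P {j} ({j}ᶜ)

/-- Expectation under the single-step distribution `π`. -/
noncomputable def expPi {Ω : Type} [Fintype Ω] (π : Ω → ℝ) (f : Ω → ℝ) : ℝ :=
  ∑ a, π a * f a

/-- Variance under the single-step distribution `π`. -/
noncomputable def varPi {Ω : Type} [Fintype Ω] (π : Ω → ℝ) (f : Ω → ℝ) : ℝ :=
  expPi π (fun a => (f a - expPi π f) ^ 2)

/-- The influence `Inf_i(f(X))` of coordinate `i`, where `X` has product law `πⁿ`. -/
noncomputable def influence {Ω : Type} [Fintype Ω] {n : ℕ}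
    (π : Ω → ℝ) (i : Fin n) (f : (Fin n → Ω) → ℝ) : ℝ :=
  ∑ v : Fin n → Ω, (∏ k, π (v k)) * varPi π (fun a => f (Function.update v i a))

/-- The function obtained from `f` by applying the restriction `R`
(`none` means unrestricted). -/
def restrict {Ω : Type} {n : ℕ} (R : Fin n → Option Ω)
    (f : (Fin n → Ω) → ℝ) : (Fin n → Ω) → ℝ :=
  fun x => f (fun i => (R i).getD (x i))

/-- The size (number of restricted coordinates) of a restriction. -/
def restSize {Ω : Type} {n : ℕ} (R : Fin n → Option Ω) : ℕ :=
  (Finset.univ.filter (fun i => (R i).isSome = true)).card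

/-- `f` is `ε`-resilient up to size `k` (with respect to the product law `πⁿ`). -/
def Resilient {Ω : Type} [Fintype Ω] {n : ℕ} (π : Ω → ℝ) (ε : ℝ) (k : ℕ)
    (f : (Fin n → Ω) → ℝ) : Prop :=
  ∀ R : Fin n → Option Ω, restSize R ≤ k →
    (1 - ε) * exps π f ≤ exps π (restrict R f) ∧
    exps π (restrict R f) ≤ (1 + ε) * exps π f

/-- The restriction operator `R[i,a]`. -/
def restrOp {Ω : Type} {n : ℕ} (i : Fin n) (a : Ω)
    (f : (Fin n → Ω) → ℝ) : (Fin n → Ω) → ℝ :=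
  fun x => f (Function.update x i a)

/-- The maximum operator `M[i,y,z]`. -/
def maxOp {Ω : Type} {n : ℕ} (i : Fin n) (y z : Ω)
    (f : (Fin n → Ω) → ℝ) : (Fin n → Ω) → ℝ :=
  fun x => max (f (Function.update x i y)) (f (Function.update x i z))

/-- Insert the value `a` at position `j` into `w : Ω^{[ℓ] ∖ {j}}`. -/
def ins {Ω : Type} {ℓ : ℕ} (j : Fin ℓ) (w : {k : Fin ℓ // k ≠ j} → Ω) (a : Ω) :
    Fin ℓ → Ω :=
  fun k => if h : k = j then a else w ⟨k, h⟩

/-- The probability that the coordinates other than `j` equal `w`. -/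
noncomputable def margOff {Ω : Type} [Fintype Ω] {ℓ : ℕ}
    (P : (Fin ℓ → Ω) → ℝ) (j : Fin ℓ) (w : {k : Fin ℓ // k ≠ j} → Ω) : ℝ :=
  ∑ a, P (ins j w a)

open Classical in
/-- The joint law of `(Y, Z)` for a double sample on step `j` from `P`. -/
noncomputable def doubleSample {Ω : Type} [Fintype Ω] {ℓ : ℕ}
    (P : (Fin ℓ → Ω) → ℝ) (j : Fin ℓ) (y z : Ω) : ℝ :=
  ∑ w : {k : Fin ℓ // k ≠ j} → Ω,
    if margOff P j w = 0 then 0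
    else P (ins j w y) * P (ins j w z) / margOff P j w


theorem sum_split {Ω : Type} [Fintype Ω] {ℓ m : ℕ}
    (P : (Fin ℓ → Ω) → ℝ) (i : Fin (m+1)) (h : (Fin ℓ → Fin (m+1) → Ω) → ℝ) :
    ∑ x : Fin ℓ → Fin (m+1) → Ω, (∏ i, P (fun j => x j i)) * h x =
      ∑ r : Fin m → Fin ℓ → Ω, (∏ k, P (r k)) *
        ∑ a : Fin ℓ → Ω, P a * h (fun j => i.insertNth (α := fun _ => Ω) (a j) (fun k => r k j)) := by
  rw [← (Equiv.piComm (fun (_ : Fin (m+1)) (_ : Fin ℓ) => Ω)).sum_comp,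
    ← (Fin.insertNthEquiv (fun _ => Fin ℓ → Ω) i).sum_comp, Fintype.sum_prod_type,
    Finset.sum_comm]
  refine Finset.sum_congr rfl fun r _ => ?_
  rw [Finset.mul_sum]
  refine Finset.sum_congr rfl fun a _ => ?_
  rw [Fin.prod_univ_succAbove _ i]
  have e : (Equiv.piComm (fun (_ : Fin (m+1)) (_ : Fin ℓ) => Ω))
      ((Fin.insertNthEquiv (fun _ => Fin ℓ → Ω) i) (a, r)) =
      (fun j => i.insertNth (α := fun _ => Ω) (a j) (fun k => r k j)) := by
    funext j k
    refine Fin.succAboveCases i ?_ (fun k => ?_) k <;> simp [Equiv.piComm, Function.swap]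
  rw [e]
  simp only [Fin.insertNth_apply_same, Fin.insertNth_apply_succAbove]
  ring

/-- replacing `f^{(j*)}` by `M[i,y,z]f^{(j*)}` and `f^{(j)}` by
`R[i,x^{(j)}]f^{(j)}` loses at most a factor `β`. -/
theorem maximum_keeps_probability
    {Ω : Type} [Fintype Ω] {ℓ n : ℕ}
    (P : (Fin ℓ → Ω) → ℝ) (π : Ω → ℝ)
    (hP : IsDist P) (hm : HasMarginals P π) (hπ : ∀ a : Ω, 0 < π a)
    (i : Fin n) (jstar : Fin ℓ)
    (xbar : {k : Fin ℓ // k ≠ jstar} → Ω) (y z : Ω)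
    (β : ℝ) (hβ : 0 ≤ β)
    (hy : β ≤ P (ins jstar xbar y)) (hz : β ≤ P (ins jstar xbar z))
    (f : Fin ℓ → ((Fin n → Ω) → ℝ)) (hf : ∀ j v, f j v ∈ Set.Icc (0:ℝ) 1) :
    β * prodExp P (fun j =>
        if h : j = jstar then maxOp i y z (f j)
        else restrOp i (xbar ⟨j, h⟩) (f j))
      ≤ prodExp P f := by
  cases n with
  | zero => exact i.elim0
  | succ m =>
  unfold prodExp
  rw [sum_split P i, sum_split P i, Finset.mul_sum]
  refine Finset.sum_le_sum fun r _ => ?_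
  rw [mul_left_comm]
  refine mul_le_mul_of_nonneg_left ?_ (Finset.prod_nonneg fun k _ => hP.1 _)
  set F : (Fin ℓ → Ω) → ℝ := fun a =>
    ∏ j, f j (i.insertNth (α := fun _ => Ω) (a j) (fun k => r k j)) with hF
  have hF0 : ∀ a, 0 ≤ F a := fun a => Finset.prod_nonneg fun j _ => (hf j _).1
  have upd : ∀ (a b : Ω) (v : Fin m → Ω), Function.update
      (i.insertNth (α := fun _ => Ω) a v) i b = i.insertNth (α := fun _ => Ω) b v := by
    intro a b v
    funext k
    refine Fin.succAboveCases i ?_ (fun k => ?_) k <;> simp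
  have key : ∃ c, β ≤ P c ∧ ∀ a : Fin ℓ → Ω,
      (∏ j, (if h : j = jstar then maxOp i y z (f j)
        else restrOp i (xbar ⟨j, h⟩) (f j))
          (i.insertNth (α := fun _ => Ω) (a j) (fun k => r k j))) = F c := by
    rcases max_choice
      (f jstar (i.insertNth (α := fun _ => Ω) y (fun k => r k jstar)))
      (f jstar (i.insertNth (α := fun _ => Ω) z (fun k => r k jstar))) with hc | hc
    · refine ⟨_, hy, fun a => Finset.prod_congr rfl fun j _ => ?_⟩
      by_cases h : j = jstar
      · subst h
        simp only [dite_true, maxOp, upd, hc, ins]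
      · simp only [h, dite_false, restrOp, upd, ins]
    · refine ⟨_, hz, fun a => Finset.prod_congr rfl fun j _ => ?_⟩
      by_cases h : j = jstar
      · subst h
        simp only [dite_true, maxOp, upd, hc, ins]
      · simp only [h, dite_false, restrOp, upd, ins]
  obtain ⟨c, hc, hk⟩ := key
  simp only [hk]
  rw [← Finset.sum_mul, hP.2, one_mul]
  calc β * F c ≤ P c * F c := mul_le_mul_of_nonneg_right hc (hF0 c)
    _ ≤ ∑ a, P a * F a := Finset.single_le_sum (f := fun a => P a * F a)
        (fun a _ => mul_nonneg (hP.1 a) (hF0 a)) (Finset.mem_univ c)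

end SameSetHitting
end

section
/- Let Ω be a finite set, P an ℓ-step probability distribution on Ω^ℓ with equal marginals π (with support all of Ω), j* ∈ [ℓ], and let (X̄^{∖j*}, Y, Z) be a double sample on step j* from P. Let X = (X₁,…,Xₙ) be a random vector with law πⁿ, independent of the double sample. Then for every i ∈ [n] and every function f : Ωⁿ → [0,1], E[(M[i,Y,Z]f)(X)] ≥ E[f(X)] + τ·(1 − ρ(P)²), where τ := Inf_i(f(X)). -/
namespace SameSetHitting

theorem sum_ins {Ω : Type} [Fintype Ω] {ℓ : ℕ} (j : Fin ℓ) (φ : (Fin ℓ → Ω) → ℝ) :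
    ∑ x, φ x = ∑ w : {k : Fin ℓ // k ≠ j} → Ω, ∑ a, φ (ins j w a) := by
  rw [Finset.sum_comm, ← Fintype.sum_prod_type']
  refine Fintype.sum_equiv (Equiv.funSplitAt j Ω) _ _ ?_
  intro x
  congr 1
  funext k
  by_cases h : k = j
  · subst h; simp [ins, Equiv.funSplitAt]
  · simp [ins, h, Equiv.funSplitAt]

theorem ins_self {Ω : Type} {ℓ : ℕ} (j : Fin ℓ) (w : {k : Fin ℓ // k ≠ j} → Ω) (a : Ω) :
    ins j w a j = a := by simp [ins]

theorem ins_off {Ω : Type} {ℓ : ℕ} (j : Fin ℓ) (w : {k : Fin ℓ // k ≠ j} → Ω) (a : Ω) :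
    (fun k : {k : Fin ℓ // k ≠ j} => ins j w a k) = w := by
  funext k; simp [ins, k.2]

theorem update_ins {Ω : Type} {ℓ : ℕ} (j : Fin ℓ) (w : {k : Fin ℓ // k ≠ j} → Ω) (a b : Ω) :
    Function.update (ins j w b) j a = ins j w a := by
  funext k
  by_cases h : k = j
  · subst h; simp [ins]
  · simp [ins, h]

theorem prod_ins {Ω : Type} {n : ℕ} (π : Ω → ℝ) (j : Fin n)
    (w : {k : Fin n // k ≠ j} → Ω) (a : Ω) :
    ∏ k, π (ins j w a k) = π a * ∏ k, π (w k) := by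
  rw [Fintype.prod_eq_mul_prod_subtype_ne _ j, ins_self]
  congr 1
  refine Finset.prod_congr rfl fun k _ => ?_
  simp [ins, k.2]

theorem sum_marg {Ω : Type} [Fintype Ω] {ℓ : ℕ} {P : (Fin ℓ → Ω) → ℝ} {π : Ω → ℝ}
    (hm : HasMarginals P π) (j : Fin ℓ) (g : Ω → ℝ) :
    ∑ x, P x * g (x j) = ∑ a, π a * g a := by
  classical
  simp only [← hm j, marginal, Finset.sum_mul]
  rw [Finset.sum_comm]
  refine Finset.sum_congr rfl fun x _ => ?_
  simp [ite_mul]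

theorem marg_sum {Ω : Type} [Fintype Ω] {ℓ : ℕ} {P : (Fin ℓ → Ω) → ℝ} {π : Ω → ℝ}
    (hP : IsDist P) (hm : HasMarginals P π) (j : Fin ℓ) : ∑ a, π a = 1 := by
  have := sum_marg hm j (fun _ => 1)
  simp only [mul_one] at this
  rw [← this, hP.2]

theorem exps_resample {Ω : Type} [Fintype Ω] {n : ℕ} (π : Ω → ℝ) (h1 : ∑ a, π a = 1)
    (i : Fin n) (f : (Fin n → Ω) → ℝ) :
    exps π f = ∑ v : Fin n → Ω, (∏ k, π (v k)) * expPi π (fun a => f (Function.update v i a)) := by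
  unfold exps expPi
  rw [sum_ins i, sum_ins i]
  refine Finset.sum_congr rfl fun w _ => ?_
  simp only [prod_ins, update_ins]
  rw [← Finset.sum_mul, ← Finset.sum_mul, h1, one_mul, Finset.mul_sum]
  refine Finset.sum_congr rfl fun a _ => ?_
  ring

theorem varP_nonneg {Ω : Type} [Fintype Ω] {ℓ : ℕ} {P : (Fin ℓ → Ω) → ℝ}
    (hP : IsDist P) (f : (Fin ℓ → Ω) → ℝ) : 0 ≤ varP P f := by
  have h : 0 ≤ ∑ x, P x * (f x - expP P f) ^ 2 :=
    Finset.sum_nonneg fun x _ => mul_nonneg (hP.1 x) (sq_nonneg _)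
  have e : ∑ x, P x * (f x - expP P f) ^ 2
      = expP P (fun x => f x * f x) - 2 * expP P f * expP P f + (expP P f) ^ 2 * ∑ x, P x := by
    have e : ∀ c : ℝ, ∑ x, P x * (f x - c) ^ 2
        = expP P (fun x => f x * f x) - 2 * c * expP P f + c ^ 2 * ∑ x, P x := by
      intro c
      simp only [expP, Finset.mul_sum, ← Finset.sum_sub_distrib, ← Finset.sum_add_distrib]
      exact Finset.sum_congr rfl fun x _ => by ring
    exact e _
  rw [e, hP.2] at h
  unfold varP covP
  linarith

theorem varP_sub {Ω : Type} [Fintype Ω] {ℓ : ℕ} (P : (Fin ℓ → Ω) → ℝ)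
    (f g : (Fin ℓ → Ω) → ℝ) :
    varP P (fun x => f x - g x) = varP P f - 2 * covP P f g + varP P g := by
  have e1 : expP P (fun x => f x - g x) = expP P f - expP P g := by
    simp only [expP, mul_sub, Finset.sum_sub_distrib]
  have e2 : expP P (fun x => (f x - g x) * (f x - g x)) = expP P (fun x => f x * f x)
      - 2 * expP P (fun x => f x * g x) + expP P (fun x => g x * g x) := by
    simp only [expP, Finset.mul_sum, ← Finset.sum_sub_distrib, ← Finset.sum_add_distrib]
    exact Finset.sum_congr rfl fun x _ => by ring
  unfold varP covP
  rw [e1, e2]; ring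

theorem covP_smul {Ω : Type} [Fintype Ω] {ℓ : ℕ} (P : (Fin ℓ → Ω) → ℝ)
    (f g : (Fin ℓ → Ω) → ℝ) (c d : ℝ) :
    covP P (fun x => c * f x) (fun x => d * g x) = c * d * covP P f g := by
  have e1 : ∀ (c : ℝ) (f : (Fin ℓ → Ω) → ℝ), expP P (fun x => c * f x) = c * expP P f := by
    intro c f
    simp only [expP, Finset.mul_sum]
    exact Finset.sum_congr rfl fun x _ => by ring
  have e2 : (fun x => c * f x * (d * g x)) = fun x => (c * d) * (f x * g x) := by
    funext x; ring
  unfold covP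
  rw [e2, e1, e1, e1]; ring

theorem covP_le_one {Ω : Type} [Fintype Ω] {ℓ : ℕ} {P : (Fin ℓ → Ω) → ℝ}
    (hP : IsDist P) (f g : (Fin ℓ → Ω) → ℝ) (hf : varP P f = 1) (hg : varP P g = 1) :
    covP P f g ≤ 1 := by
  have := varP_nonneg hP (fun x => f x - g x)
  rw [varP_sub] at this
  linarith

theorem le_rho {Ω : Type} [Fintype Ω] {ℓ : ℕ} {P : (Fin ℓ → Ω) → ℝ}
    (hP : IsDist P) (j : Fin ℓ) (f g : (Fin ℓ → Ω) → ℝ)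
    (hfd : DependsOn f {j}) (hgd : DependsOn g ({j}ᶜ))
    (hf : varP P f = 1) (hg : varP P g = 1) : covP P f g ≤ rho P := by
  have h1 : covP P f g ≤ rhoST P {j} ({j}ᶜ) := by
    refine le_csSup ⟨1, ?_⟩ ⟨f, g, hfd, hgd, hf, hg, rfl⟩
    rintro r ⟨f, g, _, _, hf, hg, rfl⟩
    exact covP_le_one hP f g hf hg
  exact h1.trans (le_ciSup (f := fun j : Fin ℓ => rhoST P {j} ({j}ᶜ)) (Set.finite_range _).bddAbove j)

theorem var_le_rho {Ω : Type} [Fintype Ω] {ℓ : ℕ} {P : (Fin ℓ → Ω) → ℝ}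
    (hP : IsDist P) (j : Fin ℓ) (f g : (Fin ℓ → Ω) → ℝ)
    (hfd : DependsOn f {j}) (hgd : DependsOn g ({j}ᶜ))
    (hc : covP P f g = varP P g) : varP P g ≤ rho P ^ 2 * varP P f := by
  have hf0 := varP_nonneg hP f
  rcases (varP_nonneg hP g).eq_or_lt with h0 | hV
  · rw [← h0]; positivity
  have hFV : 0 < varP P f := by
    have := varP_nonneg hP (fun x => f x - g x)
    rw [varP_sub, hc] at this
    linarith
  set V := varP P g with hVd
  set F := varP P f with hFd
  have hsV := Real.mul_self_sqrt hV.le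
  have hsF := Real.mul_self_sqrt hFV.le
  have pV := Real.sqrt_pos.2 hV
  have pF := Real.sqrt_pos.2 hFV
  have key := le_rho hP j (fun x => (√F)⁻¹ * f x) (fun x => (√V)⁻¹ * g x)
    (fun x y h => by simp only [hfd x y h]) (fun x y h => by simp only [hgd x y h])
    (by
      unfold varP; rw [covP_smul]
      change _ * F = 1
      rw [← mul_inv, hsF]; exact inv_mul_cancel₀ hFV.ne')
    (by
      unfold varP; rw [covP_smul]
      change _ * V = 1
      rw [← mul_inv, hsV]; exact inv_mul_cancel₀ hV.ne')
  rw [covP_smul, hc] at key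
  have e : (√F)⁻¹ * (√V)⁻¹ * V = √V / √F := by
    field_simp
    nlinarith
  rw [e, div_le_iff₀ pF] at key
  calc V = √V * √V := hsV.symm
    _ ≤ (rho P * √F) * (rho P * √F) := mul_self_le_mul_self pV.le key
    _ = rho P ^ 2 * (√F * √F) := by ring
    _ = _ := by rw [hsF]

theorem doubleSample_eq {Ω : Type} [Fintype Ω] {ℓ : ℕ}
    (P : (Fin ℓ → Ω) → ℝ) (j : Fin ℓ) (y z : Ω) :
    doubleSample P j y z = ∑ w : {k : Fin ℓ // k ≠ j} → Ω,
      P (ins j w y) * P (ins j w z) / margOff P j w := by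
  unfold doubleSample
  refine Finset.sum_congr rfl fun w _ => ?_
  split_ifs with h
  · simp [h]
  · rfl

theorem margOff_zero {Ω : Type} [Fintype Ω] {ℓ : ℕ} {P : (Fin ℓ → Ω) → ℝ}
    (hP : IsDist P) (j : Fin ℓ) (w : {k : Fin ℓ // k ≠ j} → Ω) (h : margOff P j w = 0) (a : Ω) :
    P (ins j w a) = 0 :=
  (Finset.sum_eq_zero_iff_of_nonneg (fun a _ => hP.1 _)).1 h a (Finset.mem_univ _)

theorem doubleSample_nonneg {Ω : Type} [Fintype Ω] {ℓ : ℕ} {P : (Fin ℓ → Ω) → ℝ}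
    (hP : IsDist P) (j : Fin ℓ) (y z : Ω) : 0 ≤ doubleSample P j y z := by
  rw [doubleSample_eq]
  exact Finset.sum_nonneg fun w _ => div_nonneg (mul_nonneg (hP.1 _) (hP.1 _))
    (Finset.sum_nonneg fun a _ => hP.1 _)

theorem doubleSample_symm {Ω : Type} [Fintype Ω] {ℓ : ℕ} (P : (Fin ℓ → Ω) → ℝ)
    (j : Fin ℓ) (y z : Ω) : doubleSample P j y z = doubleSample P j z y := by
  simp only [doubleSample_eq, mul_comm]

theorem doubleSample_marg {Ω : Type} [Fintype Ω] {ℓ : ℕ} {P : (Fin ℓ → Ω) → ℝ} {π : Ω → ℝ}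
    (hP : IsDist P) (hm : HasMarginals P π) (j : Fin ℓ) (y : Ω) :
    ∑ z, doubleSample P j y z = π y := by
  classical
  have h := hm j y
  unfold marginal at h
  rw [sum_ins j] at h
  simp only [ins_self, Finset.sum_ite_eq', Finset.mem_univ, if_true] at h
  rw [← h]
  simp only [doubleSample_eq]
  rw [Finset.sum_comm]
  refine Finset.sum_congr rfl fun w _ => ?_
  rw [← Finset.sum_div, ← Finset.mul_sum]
  change _ * margOff P j w / _ = _
  by_cases h0 : margOff P j w = 0
  · rw [margOff_zero hP j w h0]; simp
  · field_simp

theorem doubleSample_corr {Ω : Type} [Fintype Ω] {ℓ : ℕ} {P : (Fin ℓ → Ω) → ℝ} {π : Ω → ℝ}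
    (hP : IsDist P) (hm : HasMarginals P π) (j : Fin ℓ) (g : Ω → ℝ) :
    ∑ y, ∑ z, doubleSample P j y z * (g y * g z)
      ≤ (∑ a, π a * g a) ^ 2
        + rho P ^ 2 * (∑ a, π a * (g a * g a) - (∑ a, π a * g a) ^ 2) := by
  set s : ({k : Fin ℓ // k ≠ j} → Ω) → ℝ := fun w => ∑ a, P (ins j w a) * g a with hs
  set h : ({k : Fin ℓ // k ≠ j} → Ω) → ℝ := fun w => s w / margOff P j w with hh
  have hmh : ∀ w, margOff P j w * h w = s w := by
    intro w
    by_cases h0 : margOff P j w = 0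
    · simp only [hs, h0, zero_mul, margOff_zero hP j w h0, Finset.sum_const_zero]
    · simp only [hh]; field_simp
  set G : (Fin ℓ → Ω) → ℝ := fun x => g (x j) with hG
  set H : (Fin ℓ → Ω) → ℝ := fun x => h (fun k => x k) with hH
  have hHi : ∀ w a, H (ins j w a) = h w := fun w a => by simp only [hH, ins_off]
  have hGi : ∀ w a, G (ins j w a) = g a := fun w a => by simp only [hG, ins_self]
  have eG : expP P G = ∑ a, π a * g a := sum_marg hm j g
  have eGG : expP P (fun x => G x * G x) = ∑ a, π a * (g a * g a) :=
    sum_marg hm j (fun a => g a * g a)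
  have eH : expP P H = expP P G := by
    unfold expP
    rw [sum_ins j, sum_ins j]
    refine Finset.sum_congr rfl fun w _ => ?_
    simp only [hHi, hGi]
    rw [← Finset.sum_mul]
    exact hmh w
  have eGH : expP P (fun x => G x * H x) = ∑ w, s w * h w := by
    unfold expP
    rw [sum_ins j]
    refine Finset.sum_congr rfl fun w _ => ?_
    simp only [hHi, hGi, hs, Finset.sum_mul]
    exact Finset.sum_congr rfl fun a _ => by ring
  have eHH : expP P (fun x => H x * H x) = ∑ w, s w * h w := by
    unfold expP
    rw [sum_ins j]
    refine Finset.sum_congr rfl fun w _ => ?_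
    simp only [hHi]
    rw [← Finset.sum_mul, ← mul_assoc]
    congr 1
    exact hmh w
  have eD : ∑ y, ∑ z, doubleSample P j y z * (g y * g z) = ∑ w, s w * h w := by
    simp only [doubleSample_eq, Finset.sum_mul]
    rw [Finset.sum_congr rfl fun y _ => Finset.sum_comm, Finset.sum_comm]
    refine Finset.sum_congr rfl fun w _ => ?_
    simp only [hh, ← mul_div_assoc, hs, Finset.sum_mul_sum, Finset.sum_div]
    exact Finset.sum_congr rfl fun y _ => Finset.sum_congr rfl fun z _ => by ring
  have key := var_le_rho hP j G H (fun x y hxy => by simp [hG, hxy])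
    (fun x y hxy => by
      simp only [hH]
      congr 1
      funext k
      exact hxy k (by simpa using k.2))
    (by unfold varP covP; rw [eGH, eHH, eH])
  unfold varP covP at key
  rw [eHH, eGG, eH, eG, ← eD] at key
  linarith [key]

theorem varPi_eq {Ω : Type} [Fintype Ω] (π : Ω → ℝ) (h1 : ∑ a, π a = 1) (g : Ω → ℝ) :
    varPi π g = ∑ a, π a * (g a * g a) - (∑ a, π a * g a) ^ 2 := by
  unfold varPi
  have e : ∀ c : ℝ, expPi π (fun a => (g a - c) ^ 2)
      = ∑ a, π a * (g a * g a) - 2 * c * ∑ a, π a * g a + c ^ 2 * ∑ a, π a := by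
    intro c
    simp only [expPi, Finset.mul_sum, ← Finset.sum_sub_distrib, ← Finset.sum_add_distrib]
    exact Finset.sum_congr rfl fun x _ => by ring
  rw [e, h1]
  unfold expPi
  ring

theorem max_bound {a b : ℝ} (ha : a ∈ Set.Icc (0:ℝ) 1) (hb : b ∈ Set.Icc (0:ℝ) 1) :
    (a + b) / 2 + (a * a + b * b) / 2 - a * b ≤ max a b := by
  obtain ⟨a0, a1⟩ := ha
  obtain ⟨b0, b1⟩ := hb
  rcases le_total a b with h | h
  · rw [max_eq_right h]; nlinarith
  · rw [max_eq_left h]; nlinarith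

theorem one_step {Ω : Type} [Fintype Ω] {ℓ : ℕ} {P : (Fin ℓ → Ω) → ℝ} {π : Ω → ℝ}
    (hP : IsDist P) (hm : HasMarginals P π) (j : Fin ℓ) (g : Ω → ℝ)
    (hg : ∀ a, g a ∈ Set.Icc (0:ℝ) 1) :
    expPi π g + varPi π g * (1 - rho P ^ 2)
      ≤ ∑ y, ∑ z, doubleSample P j y z * max (g y) (g z) := by
  have hL : ∀ φ : Ω → ℝ, ∑ y, ∑ z, doubleSample P j y z * φ y = ∑ a, π a * φ a := by
    intro φ
    refine Finset.sum_congr rfl fun y _ => ?_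
    rw [← Finset.sum_mul, doubleSample_marg hP hm]
  have hR : ∀ φ : Ω → ℝ, ∑ y, ∑ z, doubleSample P j y z * φ z = ∑ a, π a * φ a := by
    intro φ
    rw [Finset.sum_comm, ← hL]
    exact Finset.sum_congr rfl fun y _ => Finset.sum_congr rfl fun z _ => by
      rw [doubleSample_symm]
  have hb : ∑ y, ∑ z, doubleSample P j y z *
      ((g y + g z) / 2 + (g y * g y + g z * g z) / 2 - g y * g z)
      ≤ ∑ y, ∑ z, doubleSample P j y z * max (g y) (g z) :=
    Finset.sum_le_sum fun y _ => Finset.sum_le_sum fun z _ =>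
      mul_le_mul_of_nonneg_left (max_bound (hg y) (hg z)) (doubleSample_nonneg hP j y z)
  have e : ∑ y, ∑ z, doubleSample P j y z *
      ((g y + g z) / 2 + (g y * g y + g z * g z) / 2 - g y * g z)
      = (1/2) * (∑ y, ∑ z, doubleSample P j y z * g y)
        + (1/2) * (∑ y, ∑ z, doubleSample P j y z * g z)
        + (1/2) * (∑ y, ∑ z, doubleSample P j y z * (g y * g y))
        + (1/2) * (∑ y, ∑ z, doubleSample P j y z * (g z * g z))
        - ∑ y, ∑ z, doubleSample P j y z * (g y * g z) := by
    simp only [Finset.mul_sum, ← Finset.sum_sub_distrib, ← Finset.sum_add_distrib]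
    exact Finset.sum_congr rfl fun y _ => Finset.sum_congr rfl fun z _ => by ring
  rw [hL g, hR g, hL (fun a => g a * g a), hR (fun a => g a * g a)] at e
  have hc := doubleSample_corr hP hm j g
  rw [varPi_eq π (marg_sum hP hm j)]
  unfold expPi
  linarith

/-- taking the maximum over a double sample increases the
expectation by at least `Inf_i(f)·(1 − ρ(P)²)`. -/
theorem max_over_double_sample_increases_expectation
    {Ω : Type} [Fintype Ω] {ℓ n : ℕ}
    (P : (Fin ℓ → Ω) → ℝ) (π : Ω → ℝ)
    (hP : IsDist P) (hm : HasMarginals P π) (hπ : ∀ a : Ω, 0 < π a)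
    (jstar : Fin ℓ) (i : Fin n)
    (f : (Fin n → Ω) → ℝ) (hf : ∀ v, f v ∈ Set.Icc (0:ℝ) 1) :
    exps π f + influence π i f * (1 - rho P ^ 2) ≤
      ∑ y : Ω, ∑ z : Ω, doubleSample P jstar y z * exps π (maxOp i y z f) := by
  have e : ∑ y : Ω, ∑ z : Ω, doubleSample P jstar y z * exps π (maxOp i y z f)
      = ∑ v : Fin n → Ω, (∏ k, π (v k)) * ∑ y, ∑ z, doubleSample P jstar y z *
          max (f (Function.update v i y)) (f (Function.update v i z)) := by
    simp only [exps, maxOp, Finset.mul_sum]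
    rw [Finset.sum_congr rfl fun y _ => Finset.sum_comm, Finset.sum_comm]
    exact Finset.sum_congr rfl fun v _ => Finset.sum_congr rfl fun y _ =>
      Finset.sum_congr rfl fun z _ => by ring
  rw [e, exps_resample π (marg_sum hP hm jstar) i f]
  unfold influence
  rw [Finset.sum_mul, ← Finset.sum_add_distrib]
  refine Finset.sum_le_sum fun v _ => ?_
  rw [mul_assoc, ← mul_add]
  exact mul_le_mul_of_nonneg_left
    (one_step hP hm jstar (fun a => f (Function.update v i a)) fun a => hf _)
    (Finset.prod_nonneg fun k _ => (hπ _).le)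

end SameSetHitting
end

section
/- Let C be an (s,p)-cycle over a finite set Ω (so s ≥ 2 and p ∈ (0,1)). Then ρ(C) ≤ 1 − 7p(1−p)/s². -/
namespace SameSetHitting

/-- `C` is an `(s,p)`-cycle over `Ω`. -/
def IsCycle {Ω : Type} (C : (Fin 2 → Ω) → ℝ) (s : ℕ) (p : ℝ) : Prop :=
  ∃ x : ZMod s → Ω, Function.Injective x ∧
    (∀ i : ZMod s, C ![x i, x i] = p / (s : ℝ)) ∧
    (∀ i : ZMod s, C ![x i, x (i + 1)] = (1 - p) / (s : ℝ)) ∧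
    (∀ ab : Fin 2 → Ω,
      (∀ i : ZMod s, ¬(ab 0 = x i ∧ ab 1 = x i) ∧
        ¬(ab 0 = x i ∧ ab 1 = x (i + 1))) →
      C ab = 0)

lemma sum_poly (m : ℝ) (n : ℕ) :
    ∑ d ∈ Finset.range n, (d:ℝ)^2 * (m - d)^2
      = m^2 * ((n:ℝ)*(n-1)*(2*n-1)/6) - 2*m*((n:ℝ)*(n-1)/2)^2
        + (n:ℝ)*(n-1)*(2*n-1)*(3*n^2-3*n-1)/30 := by
  induction n with
  | zero => simp
  | succ k ih => rw [Finset.sum_range_succ, ih]; push_cast; ring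

lemma shift_bound {s : ℕ} [NeZero s] (G : ZMod s → ℝ) (d : ℕ) :
    ∑ i, (G (i + d) - G i)^2 ≤ (d:ℝ)^2 * ∑ i, (G (i + 1) - G i)^2 := by
  induction d with
  | zero => simp
  | succ k ih =>
    rcases Nat.eq_zero_or_pos k with rfl | hk
    · simp
    have hk' : (0:ℝ) < k := by exact_mod_cast hk
    have h1 : ∑ i, (G (i + k + 1) - G (i + k))^2 = ∑ i, (G (i + 1) - G i)^2 :=
      Equiv.sum_comp (Equiv.addRight (k : ZMod s)) (fun i => (G (i + 1) - G i)^2)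
    have h2 : ∑ i, (G (i + (k + 1 : ℕ)) - G i)^2 ≤
        ∑ i, ((1 + 1/(k:ℝ)) * (G (i + k) - G i)^2 + (1 + k) * (G (i + k + 1) - G (i + k))^2) := by
      apply Finset.sum_le_sum
      intro i _
      have e : i + ((k + 1 : ℕ) : ZMod s) = i + k + 1 := by push_cast; ring
      rw [e]
      set a := G (i + k) - G i
      set b := G (i + k + 1) - G (i + k)
      have e2 : G (i + k + 1) - G i = a + b := by simp only [a, b]; ring
      rw [e2]
      have : (1 + 1/(k:ℝ)) * a^2 + (1 + k) * b^2 - (a + b)^2 = (a - k * b)^2 / k := by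
        field_simp; ring
      have h3 : 0 ≤ (a - k * b)^2 / k := by positivity
      linarith
    rw [Finset.sum_add_distrib, ← Finset.mul_sum, ← Finset.mul_sum, h1] at h2
    refine h2.trans ?_
    have h4 := mul_le_mul_of_nonneg_left ih (by positivity : 0 ≤ 1 + 1/(k:ℝ))
    refine (add_le_add_left h4 _).trans (le_of_eq ?_)
    push_cast
    field_simp
    ring

lemma shift_bound' {s : ℕ} [NeZero s] (G : ZMod s → ℝ) (d : ℕ) (hd : d ≤ s) :
    ∑ i, (G (i + d) - G i)^2 ≤ ((s:ℝ) - d)^2 * ∑ i, (G (i + 1) - G i)^2 := by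
  have h := shift_bound G (s - d)
  have hc : ((s - d : ℕ) : ℝ) = (s:ℝ) - d := Nat.cast_sub hd
  have hz : ((s - d : ℕ) : ZMod s) = - d := by rw [Nat.cast_sub hd]; simp
  rw [hc, hz] at h
  refine le_trans (le_of_eq ?_) h
  have e := Equiv.sum_comp (Equiv.addRight (d : ZMod s)) (fun i => (G (i + -(d : ZMod s)) - G i)^2)
  rw [← e]
  apply Finset.sum_congr rfl
  intro i _
  simp only [Equiv.coe_addRight, add_neg_cancel_right]
  ring

lemma shift_bound'' {s : ℕ} [NeZero s] (G : ZMod s → ℝ) (d : ℕ) (hd : d ≤ s) :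
    ∑ i, (G (i + d) - G i)^2 ≤
      4 * ((d:ℝ)^2 * ((s:ℝ) - d)^2) / (s:ℝ)^2 * ∑ i, (G (i + 1) - G i)^2 := by
  have hs : (0:ℝ) < s := by exact_mod_cast Nat.pos_of_ne_zero (NeZero.ne s)
  have hd' : (d:ℝ) ≤ s := by exact_mod_cast hd
  have hd0 : (0:ℝ) ≤ d := by positivity
  have hE : 0 ≤ ∑ i, (G (i + 1) - G i)^2 := Finset.sum_nonneg (fun i _ => sq_nonneg _)
  rcases le_total (2 * (d:ℝ)) s with h | h
  · refine (shift_bound G d).trans (mul_le_mul_of_nonneg_right ?_ hE)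
    rw [le_div_iff₀ (by positivity)]
    have : (s:ℝ)^2 ≤ (2 * (s - d))^2 := pow_le_pow_left₀ hs.le (by linarith) 2
    nlinarith [mul_le_mul_of_nonneg_left this (sq_nonneg (d:ℝ))]
  · refine (shift_bound' G d hd).trans (mul_le_mul_of_nonneg_right ?_ hE)
    rw [le_div_iff₀ (by positivity)]
    have : (s:ℝ)^2 ≤ (2 * d)^2 := pow_le_pow_left₀ hs.le (by linarith) 2
    nlinarith [mul_le_mul_of_nonneg_left this (sq_nonneg ((s:ℝ) - d))]

lemma sum_zmod {s : ℕ} [NeZero s] (φ : ℕ → ℝ) :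
    ∑ d : ZMod s, φ d.val = ∑ d ∈ Finset.range s, φ d := by
  cases s with
  | zero => exact absurd rfl (NeZero.ne 0)
  | succ n => exact Fin.sum_univ_eq_sum_range φ (n + 1)

lemma poincare {s : ℕ} [NeZero s] (G : ZMod s → ℝ) (h0 : ∑ i, G i = 0) :
    14 * ∑ i, G i ^ 2 ≤ (s:ℝ)^2 * ∑ i, (G (i + 1) - G i)^2 := by
  have hs : (0:ℝ) < s := by exact_mod_cast Nat.pos_of_ne_zero (NeZero.ne s)
  have hE : 0 ≤ ∑ i, (G (i + 1) - G i)^2 := Finset.sum_nonneg (fun i _ => sq_nonneg _)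
  have e1 : ∑ d : ZMod s, ∑ i, (G (i + d) - G i)^2 = 2 * s * ∑ i, G i ^ 2 := by
    rw [Finset.sum_comm]
    have : ∀ i, ∑ d, (G (i + d) - G i)^2 = ∑ j, G j ^ 2 + s * G i ^ 2 := by
      intro i
      have h := Equiv.sum_comp (Equiv.addLeft i) (fun j => (G j - G i)^2)
      simp only [Equiv.coe_addLeft] at h
      rw [h]
      simp only [sub_sq, Finset.sum_add_distrib, Finset.sum_sub_distrib, ← Finset.sum_mul,
        ← Finset.mul_sum, h0]
      simp [ZMod.card]
    simp only [this, Finset.sum_add_distrib, ← Finset.mul_sum]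
    simp [ZMod.card]
    ring
  have e2 : ∑ d : ZMod s, ∑ i, (G (i + d) - G i)^2 ≤
      ∑ d : ZMod s, 4 * ((d.val:ℝ)^2 * ((s:ℝ) - d.val)^2) / (s:ℝ)^2
        * ∑ i, (G (i + 1) - G i)^2 := by
    apply Finset.sum_le_sum
    intro d _
    have := shift_bound'' G d.val (ZMod.val_lt d).le
    simpa using this
  rw [e1, ← Finset.sum_mul, ← Finset.sum_div, ← Finset.mul_sum,
    sum_zmod (fun d => (d:ℝ)^2 * ((s:ℝ) - d)^2), sum_poly] at e2
  set E := ∑ i, (G (i + 1) - G i)^2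
  set S := ∑ i, G i ^ 2
  have e3 : 4 * ((s:ℝ)^2 * ((s:ℝ)*(s-1)*(2*s-1)/6) - 2*s*((s:ℝ)*(s-1)/2)^2
        + (s:ℝ)*(s-1)*(2*s-1)*(3*s^2-3*s-1)/30) / (s:ℝ)^2 ≤ s * (s^2 / 7) := by
    rw [div_le_iff₀ (by positivity)]
    have : (0:ℝ) ≤ (s:ℝ)^5 := by positivity
    nlinarith
  have e4 := e2.trans (mul_le_mul_of_nonneg_right e3 hE)
  have e5 : (s:ℝ) * (14 * S) ≤ s * ((s:ℝ)^2 * E) := by linarith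
  exact le_of_mul_le_mul_left e5 hs

lemma core {s : ℕ} [NeZero s] (p : ℝ) (hp : p ∈ Set.Ioo (0:ℝ) 1) (F G : ZMod s → ℝ)
    (hG : ∑ i, G i = 0) (hF2 : ∑ i, F i ^ 2 = s) (hG2 : ∑ i, G i ^ 2 = s) :
    ∑ i, F i * (p * G i + (1 - p) * G (i + 1)) ≤ s * (1 - 7 * p * (1 - p) / (s:ℝ)^2) := by
  have hs : (0:ℝ) < s := by exact_mod_cast Nat.pos_of_ne_zero (NeZero.ne s)
  have hP := poincare G hG
  set E := ∑ i, (G (i + 1) - G i)^2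
  have h1 : ∑ i, G (i + 1) ^ 2 = s := by
    rw [← hG2]; exact Equiv.sum_comp (Equiv.addRight (1 : ZMod s)) (fun i => G i ^ 2)
  have h2 : ∑ i, F i * (p * G i + (1 - p) * G (i + 1)) ≤
      ∑ i, (F i ^ 2 / 2 + p / 2 * G i ^ 2 + (1 - p) / 2 * G (i + 1) ^ 2
        - p * (1 - p) / 2 * (G (i + 1) - G i)^2) := by
    apply Finset.sum_le_sum
    intro i _
    nlinarith [sq_nonneg (F i - (p * G i + (1 - p) * G (i + 1)))]
  rw [Finset.sum_sub_distrib, Finset.sum_add_distrib, Finset.sum_add_distrib,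
    ← Finset.sum_div, ← Finset.mul_sum, ← Finset.mul_sum, ← Finset.mul_sum, h1, hG2, hF2] at h2
  refine h2.trans ?_
  have hE : 14 / s ≤ E := by
    rw [div_le_iff₀ hs]
    rw [hG2] at hP
    nlinarith
  have hpp : 0 ≤ p * (1 - p) / 2 := by
    have := mul_nonneg hp.1.le (sub_nonneg.2 hp.2.le); linarith
  have h3 := mul_le_mul_of_nonneg_left hE hpp
  have h4 : (s:ℝ) * (1 - 7 * p * (1 - p) / (s:ℝ)^2) = s - p * (1 - p) / 2 * (14 / s) := by
    field_simp; ring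
  rw [h4]
  linarith

lemma exp_cycle {Ω : Type} [Fintype Ω] (s : ℕ) [NeZero s] (hs : 2 ≤ s) (p : ℝ)
    (C : (Fin 2 → Ω) → ℝ) (x : ZMod s → Ω) (hx : Function.Injective x)
    (h1 : ∀ i : ZMod s, C ![x i, x i] = p / (s : ℝ))
    (h2 : ∀ i : ZMod s, C ![x i, x (i + 1)] = (1 - p) / (s : ℝ))
    (h3 : ∀ ab : Fin 2 → Ω,
      (∀ i : ZMod s, ¬(ab 0 = x i ∧ ab 1 = x i) ∧
        ¬(ab 0 = x i ∧ ab 1 = x (i + 1))) → C ab = 0) (F : (Fin 2 → Ω) → ℝ) :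
    expP C F = (∑ i, (p * F ![x i, x i] + (1 - p) * F ![x i, x (i + 1)])) / s := by
  have : Fact (1 < s) := ⟨hs⟩
  let e : ZMod s ⊕ ZMod s → (Fin 2 → Ω) :=
    Sum.elim (fun i => ![x i, x i]) (fun i => ![x i, x (i + 1)])
  have he : Function.Injective e := by
    rintro (i | i) (j | j) h
    · have a : i = j := hx (congrFun h 0)
      rw [a]
    · have a : i = j := hx (congrFun h 0)
      have b : i = j + 1 := hx (congrFun h 1)
      rw [a] at b; simp at b
    · have a : i = j := hx (congrFun h 0)
      have b : i + 1 = j := hx (congrFun h 1)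
      rw [a] at b; simp at b
    · have a : i = j := hx (congrFun h 0)
      rw [a]
  unfold expP
  rw [← Fintype.sum_of_injective e he (fun t => C (e t) * F (e t)) _ ?_ (fun _ => rfl)]
  · simp only [Fintype.sum_sum_type, e, Sum.elim_inl, Sum.elim_inr, h1, h2]
    rw [← Finset.sum_add_distrib, Finset.sum_div]
    apply Finset.sum_congr rfl
    intro i _
    ring
  · intro ab hab
    rw [h3 ab, zero_mul]
    intro i
    constructor
    · rintro ⟨a, b⟩
      apply hab
      refine ⟨Sum.inl i, ?_⟩
      funext k
      fin_cases k <;> simp [e, a, b]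
    · rintro ⟨a, b⟩
      apply hab
      refine ⟨Sum.inr i, ?_⟩
      funext k
      fin_cases k <;> simp [e, a, b]

lemma cov_bound {Ω : Type} [Fintype Ω] (s : ℕ) (hs : 2 ≤ s)
    (p : ℝ) (hp : p ∈ Set.Ioo (0:ℝ) 1)
    (C : (Fin 2 → Ω) → ℝ) (hcyc : IsCycle C s p) (f g : (Fin 2 → Ω) → ℝ)
    (hf : DependsOn f {0}) (hg : DependsOn g {1}) (vf : varP C f = 1) (vg : varP C g = 1) :
    covP C f g ≤ 1 - 7 * p * (1 - p) / (s : ℝ) ^ 2 := by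
  have : NeZero s := ⟨by omega⟩
  have hs0 : (0:ℝ) < s := by exact_mod_cast Nat.pos_of_ne_zero (NeZero.ne s)
  obtain ⟨x, hx, h1, h2, h3⟩ := hcyc
  have hE := exp_cycle s hs p C x hx h1 h2 h3
  set F : ZMod s → ℝ := fun i => f ![x i, x i] with hF
  set G : ZMod s → ℝ := fun i => g ![x i, x i] with hG
  have eF : ∀ i, f ![x i, x i] = F i := fun i => rfl
  have eG : ∀ i, g ![x i, x i] = G i := fun i => rfl
  have eF' : ∀ i, f ![x i, x (i + 1)] = F i := fun i => hf _ _ (by simp)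
  have eG' : ∀ i, g ![x i, x (i + 1)] = G (i + 1) := fun i => hg _ _ (by simp)
  have sh : ∀ φ : ZMod s → ℝ, ∑ i, φ (i + 1) = ∑ i, φ i := fun φ =>
    Equiv.sum_comp (Equiv.addRight (1 : ZMod s)) φ
  have sG1 := sh G
  have sG2 := sh (fun i => G i * G i)
  simp only [varP, covP, hE, eF, eG, eF', eG'] at vf vg ⊢
  simp only [Finset.sum_add_distrib, ← Finset.mul_sum, sG1, sG2] at vf vg ⊢
  set mF := (∑ i, F i) / s with hmF
  set mG := (∑ i, G i) / s with hmG
  have sF : ∑ i, F i = s * mF := by rw [hmF]; field_simp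
  have sG : ∑ i, G i = s * mG := by rw [hmG]; field_simp
  rw [sF] at vf
  rw [sG] at vg
  have vF : ∑ i, F i * F i = s * (1 + mF^2) := by
    have t : (∑ i, F i * F i) / s - mF^2 = 1 := by
      rw [← vf]; field_simp; ring
    field_simp at t
    simp only [← pow_two]
    linarith
  have vG : ∑ i, G i * G i = s * (1 + mG^2) := by
    have t : (∑ i, G i * G i) / s - mG^2 = 1 := by
      rw [← vg]; field_simp; ring
    field_simp at t
    simp only [← pow_two]
    linarith
  have key := core p hp (fun i => F i - mF) (fun i => G i - mG) ?_ ?_ ?_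
  · have e : ∑ i, (F i - mF) * (p * (G i - mG) + (1 - p) * (G (i + 1) - mG)) =
        p * ∑ i, F i * G i + (1 - p) * ∑ i, F i * G (i + 1) - s * (mF * mG) := by
      have : ∀ i, (F i - mF) * (p * (G i - mG) + (1 - p) * (G (i + 1) - mG)) =
        p * (F i * G i) + (1 - p) * (F i * G (i + 1)) - mG * F i - mF * p * G i
          - mF * (1 - p) * G (i + 1) + mF * mG := fun i => by ring
      simp only [this, Finset.sum_add_distrib, Finset.sum_sub_distrib, ← Finset.mul_sum, sG1, sF, sG]
      simp [ZMod.card]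
      ring
    rw [e] at key
    rw [sF, sG]
    have t : (p * ∑ i, F i * G i + (1 - p) * ∑ i, F i * G (i + 1)) / s
        - (p * (s * mF) + (1 - p) * (s * mF)) / s * ((p * (s * mG) + (1 - p) * (s * mG)) / s)
        = (p * ∑ i, F i * G i + (1 - p) * ∑ i, F i * G (i + 1) - s * (mF * mG)) / s := by
      field_simp
      ring
    rw [t, div_le_iff₀ hs0]
    linarith
  · simp [Finset.sum_sub_distrib, sG, ZMod.card]
  · have : ∀ i, (F i - mF)^2 = F i * F i - 2 * mF * F i + mF^2 := fun i => by ring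
    simp only [this, Finset.sum_add_distrib, Finset.sum_sub_distrib, ← Finset.mul_sum, sF, vF]
    simp [ZMod.card]
    ring
  · have : ∀ i, (G i - mG)^2 = G i * G i - 2 * mG * G i + mG^2 := fun i => by ring
    simp only [this, Finset.sum_add_distrib, Finset.sum_sub_distrib, ← Finset.mul_sum, sG, vG]
    simp [ZMod.card]
    ring

/-- the correlation of an `(s,p)`-cycle is at most
`1 − 7p(1−p)/s²`. -/
theorem cycle_rho_bound
    {Ω : Type} [Fintype Ω] (s : ℕ) (hs : 2 ≤ s)
    (p : ℝ) (hp : p ∈ Set.Ioo (0:ℝ) 1)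
    (C : (Fin 2 → Ω) → ℝ) (hC : IsDist C) (hcyc : IsCycle C s p) :
    rho C ≤ 1 - 7 * p * (1 - p) / (s : ℝ) ^ 2 := by
  have hs' : (2:ℝ) ≤ s := by exact_mod_cast hs
  have hb : 0 ≤ 1 - 7 * p * (1 - p) / (s : ℝ) ^ 2 := by
    rw [sub_nonneg, div_le_one (by positivity)]
    nlinarith [sq_nonneg (2 * p - 1)]
  unfold rho
  apply ciSup_le
  intro j
  apply Real.sSup_le _ hb
  rintro r ⟨f, g, hf, hg, vf, vg, rfl⟩
  fin_cases j
  · exact cov_bound s hs p hp C hcyc f g hf hg vf vg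
  · have : covP C f g = covP C g f := by
      simp only [covP, mul_comm]
    rw [this]
    exact cov_bound s hs p hp C hcyc g f hg hf vg vf

end SameSetHitting
end
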